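/- arXiv:2311.10838 — 2 statements merged into one kernel-verified Lean document; each statement's English description precedes it below -/
import Mathlib

section
/- Integrability of the grazing weight over velocities (planar model): for 0 < β < 1/2, c > 0, r ≥ 0, and any unit vector n ∈ ℝ³, sup over v ∈ ℝ³ of ∫_{ζ·n ≤ 0} e^{−c|v−ζ|²}/|v−ζ| · ⟨ζ⟩^r / (|n·ζ̂|^{2β} |ζ|^{2β}) dζ ≤ C_{β,c,r} ⟨v⟩^{r+1−2β}, where ζ̂ = ζ/|ζ| and ⟨ζ⟩ = √(1+|ζ|²). -/
open Real MeasureTheory RealInnerProductSpace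

lemma oneD_bound (k γ : ℝ) (hk : 0 < k) (hγ0 : 0 < γ) (hγ1 : γ < 1) :
    ∃ K : ℝ, 0 ≤ K ∧ ∀ a b : ℝ,
      Integrable (fun s : ℝ => Real.exp (-k * (a - s) ^ 2) * |b - s| ^ (-γ)) ∧
      ∫ s : ℝ, Real.exp (-k * (a - s) ^ 2) * |b - s| ^ (-γ) ≤ K := by
  set g : ℝ → ℝ := (Set.Ioc (0:ℝ) 1).indicator (fun s => s ^ (-γ)) with hg
  have hgi : Integrable g := by
    rw [hg, integrable_indicator_iff measurableSet_Ioc]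
    have := intervalIntegral.intervalIntegrable_rpow' (a := 0) (b := 1) (r := -γ) (by linarith)
    rwa [intervalIntegrable_iff_integrableOn_Ioc_of_le zero_le_one] at this
  have hg0 : ∀ s, 0 ≤ g s := by
    intro s
    refine Set.indicator_nonneg ?_ s
    intro x hx
    exact Real.rpow_nonneg hx.1.le _
  set e : ℝ → ℝ := fun s => Real.exp (-k * s ^ 2) with he
  have hei : Integrable e := integrable_exp_neg_mul_sq hk
  have he0 : ∀ s, 0 ≤ e s := fun s => (Real.exp_pos _).le
  have he1 : ∀ s, e s ≤ 1 := fun s => by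
    rw [he]
    simp only [Real.exp_le_one_iff]
    nlinarith [mul_nonneg hk.le (sq_nonneg s)]
  refine ⟨(∫ s, g s) + (∫ s, g s) + ∫ s, e s, ?_, ?_⟩
  · have h1 : 0 ≤ ∫ s, g s := integral_nonneg fun s => hg0 s
    have h2 : 0 ≤ ∫ s, e s := integral_nonneg fun s => he0 s
    linarith
  intro a b
  have key : ∀ t X : ℝ, 0 ≤ X → X ≤ 1 → X * |t| ^ (-γ) ≤ g t + g (-t) + X := by
    intro t X h0 h1
    rcases eq_or_ne t 0 with rfl | ht
    · rw [abs_zero, Real.zero_rpow (by linarith)]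
      have := hg0 0
      have := hg0 (-0)
      linarith
    have hp : 0 < |t| := abs_pos.mpr ht
    rcases le_or_gt |t| 1 with h | h
    · have h2 : |t| ^ (-γ) ≤ g t + g (-t) := by
        rcases lt_or_gt_of_ne ht with h3 | h3
        · rw [abs_of_neg h3] at h ⊢
          have : g (-t) = (-t) ^ (-γ) := Set.indicator_of_mem (s := Set.Ioc (0:ℝ) 1) ⟨by linarith, h⟩ _
          rw [this]
          linarith [hg0 t]
        · rw [abs_of_pos h3] at h ⊢
          have : g t = t ^ (-γ) := Set.indicator_of_mem (s := Set.Ioc (0:ℝ) 1) ⟨by linarith, h⟩ _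
          rw [this]
          linarith [hg0 (-t)]
      have h4 : 0 ≤ |t| ^ (-γ) := Real.rpow_nonneg hp.le _
      nlinarith
    · have h4 : |t| ^ (-γ) ≤ 1 := Real.rpow_le_one_of_one_le_of_nonpos h.le (by linarith)
      have := hg0 t
      have := hg0 (-t)
      nlinarith
  have i1 : Integrable (fun s => g (b - s)) := hgi.comp_sub_left b
  have i2 : Integrable (fun s => g (-(b - s))) := (hgi.comp_neg).comp_sub_left b
  have i12 : Integrable (fun s => g (b - s) + g (-(b - s))) := i1.add i2
  have i3 : Integrable (fun s => e (a - s)) := hei.comp_sub_left a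
  have dom : ∀ s, Real.exp (-k * (a - s) ^ 2) * |b - s| ^ (-γ) ≤
      g (b - s) + g (-(b - s)) + e (a - s) := fun s => key _ _ (he0 (a - s)) (he1 (a - s))
  have nn : ∀ s, 0 ≤ Real.exp (-k * (a - s) ^ 2) * |b - s| ^ (-γ) := fun s => by positivity
  have ii : Integrable (fun s : ℝ => Real.exp (-k * (a - s) ^ 2) * |b - s| ^ (-γ)) := by
    refine Integrable.mono' ((i1.add i2).add i3) ?_ ?_
    · apply Measurable.aestronglyMeasurable
      fun_prop
    · refine Filter.Eventually.of_forall fun s => ?_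
      rw [Real.norm_of_nonneg (nn s)]
      exact dom s
  refine ⟨ii, ?_⟩
  calc _ ≤ ∫ s, (g (b - s) + g (-(b - s)) + e (a - s)) :=
        integral_mono ii ((i1.add i2).add i3) dom
    _ = _ := by
        rw [integral_add i12 i3, integral_add i1 i2,
          integral_sub_left_eq_self (fun s => g s), integral_sub_left_eq_self (fun s => e s),
          integral_sub_left_eq_self (fun s => g (-s)), integral_neg_eq_self]

lemma gauss_bound (c ρ : ℝ) (hc : 0 < c) (hρ : 0 ≤ ρ) :
    ∃ A : ℝ, 0 < A ∧ ∀ t : ℝ, 0 ≤ t →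
      Real.exp (-c * t) * (1 + t) ^ (ρ / 2) ≤ A * Real.exp (-(c / 2) * t) := by
  set δ := c / (ρ + 1) with hδ
  have hδ0 : 0 < δ := by positivity
  have hA : 0 < 1 + 1 / δ := by positivity
  refine ⟨(1 + 1 / δ) ^ (ρ / 2), by positivity, ?_⟩
  intro t ht
  have h1 : 1 + t ≤ (1 + 1 / δ) * Real.exp (δ * t) := by
    have h2 : δ * t + 1 ≤ Real.exp (δ * t) := Real.add_one_le_exp _
    have h3 : (1 + 1 / δ) * (δ * t + 1) = 1 + t + δ * t + 1 / δ := by field_simp; ring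
    have h4 := mul_le_mul_of_nonneg_left h2 hA.le
    have : 0 ≤ δ * t := by positivity
    have : 0 ≤ 1 / δ := by positivity
    linarith
  have h2 : (1 + t) ^ (ρ / 2) ≤ (1 + 1 / δ) ^ (ρ / 2) * Real.exp (δ * t * (ρ / 2)) := by
    calc _ ≤ ((1 + 1 / δ) * Real.exp (δ * t)) ^ (ρ / 2) :=
          Real.rpow_le_rpow (by positivity) h1 (by positivity)
      _ = _ := by rw [Real.mul_rpow hA.le (Real.exp_pos _).le, ← Real.exp_mul]
  have h5 : δ * ρ ≤ c := by
    rw [hδ, div_mul_eq_mul_div, div_le_iff₀ (by positivity)]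
    nlinarith
  calc _ ≤ Real.exp (-c * t) * ((1 + 1 / δ) ^ (ρ / 2) * Real.exp (δ * t * (ρ / 2))) := by gcongr
    _ = (1 + 1 / δ) ^ (ρ / 2) * Real.exp (-c * t + δ * t * (ρ / 2)) := by
        rw [Real.exp_add]; ring
    _ ≤ _ := by
        gcongr
        nlinarith [mul_le_mul_of_nonneg_right h5 ht]

lemma sqrt_rpow_half (x ρ : ℝ) (hx : 0 ≤ x) : Real.sqrt x ^ ρ = x ^ (ρ / 2) := by
  rw [Real.sqrt_eq_rpow, ← Real.rpow_mul hx]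
  congr 1
  ring

lemma exists_basis (n : EuclideanSpace ℝ (Fin 3)) (hn : ‖n‖ = 1) :
    ∃ b : OrthonormalBasis (Fin 3) ℝ (EuclideanSpace ℝ (Fin 3)), b 0 = n := by
  obtain ⟨b, hb⟩ := Orthonormal.exists_orthonormalBasis_extension_of_card_eq (𝕜 := ℝ)
    (E := EuclideanSpace ℝ (Fin 3)) (ι := Fin 3) (by simp) (v := fun _ => n) (s := {0}) (by
      constructor
      · intro i; simpa using hn
      · intro i j hij
        exact absurd (Subsingleton.elim i j) hij)
  exact ⟨b, hb 0 rfl⟩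

set_option maxHeartbeats 2000000 in
/-- integrability of the grazing weight over velocities: for
`0 < β < 1/2`, `c > 0`, `ρ ≥ 0` and any unit vector `n ∈ ℝ³`,
`∫_{ζ·n ≤ 0} e^{−c|v−ζ|²}/|v−ζ| · ⟨ζ⟩^ρ / (|n·ζ̂|^{2β}|ζ|^{2β}) dζ
  ≤ C ⟨v⟩^{ρ+1−2β}` uniformly in `v` and `n`. -/
theorem stmt_17 (β c ρ : ℝ) (hβ0 : 0 < β) (hβ1 : β < 1 / 2) (hc : 0 < c) (hρ : 0 ≤ ρ) :
    ∃ C > 0, ∀ v n : EuclideanSpace ℝ (Fin 3), ‖n‖ = 1 →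
      (∫ ζ in {ζ : EuclideanSpace ℝ (Fin 3) | ⟪ζ, n⟫ ≤ 0},
          Real.exp (-c * ‖v - ζ‖ ^ 2) / ‖v - ζ‖ * Real.sqrt (1 + ‖ζ‖ ^ 2) ^ ρ /
            (|⟪n, ζ⟫ / ‖ζ‖| ^ (2 * β) * ‖ζ‖ ^ (2 * β)))
        ≤ C * Real.sqrt (1 + ‖v‖ ^ 2) ^ (ρ + 1 - 2 * β) := by
  obtain ⟨K₀, hK₀, hK⟩ := oneD_bound (c / 2) (2 * β) (by positivity) (by positivity) (by linarith)
  obtain ⟨L, hL₀, hL⟩ := oneD_bound (c / 2) (1 / 2) (by positivity) (by norm_num) (by norm_num)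
  obtain ⟨A, hA, hG⟩ := gauss_bound c ρ hc hρ
  refine ⟨2 ^ (ρ / 2) * A * (K₀ * L * L) + 1, by positivity, ?_⟩
  intro v n hn
  obtain ⟨b, hb⟩ := exists_basis n hn
  set a : Fin 3 → ℝ := fun i => b.repr v i with ha
  set f : Fin 3 → ℝ → ℝ := fun i s =>
    Real.exp (-(c / 2) * (a i - s) ^ 2) *
      |(if i = 0 then 0 else a i) - s| ^ (-(if i = 0 then 2 * β else 1 / 2)) with hf
  have hfi : ∀ i, Integrable (f i) := by
    intro i
    by_cases hi : i = 0
    · simp only [hf, hi, if_true]; exact (hK _ _).1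
    · simp only [hf, hi, if_false]; exact (hL _ _).1
  have hf0 : ∀ i s, 0 ≤ f i s := fun i s => by simp only [hf]; positivity
  set ψ : EuclideanSpace ℝ (Fin 3) → (Fin 3 → ℝ) := fun ζ i => b.repr ζ i with hψ
  have hmp : MeasurePreserving ψ volume volume :=
    (EuclideanSpace.volume_preserving_symm_measurableEquiv_toLp (Fin 3)).comp
      b.measurePreserving_repr
  set F : (Fin 3 → ℝ) → ℝ := fun x => ∏ i, f i (x i) with hF
  have hFi : Integrable F := Integrable.fintype_prod hfi
  have hFint : ∫ x, F x ≤ K₀ * L * L := by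
    rw [hF, integral_fintype_prod_volume_eq_prod, Fin.prod_univ_three]
    have e0 : ∫ x, f 0 x ≤ K₀ := by simp only [hf, if_true]; exact (hK _ _).2
    have e1 : ∫ x, f 1 x ≤ L := by
      simp only [hf, one_ne_zero, if_false]; exact (hL _ _).2
    have e2 : ∫ x, f 2 x ≤ L := by
      simp only [hf, (by decide : (2 : Fin 3) ≠ 0), if_false]; exact (hL _ _).2
    have p1 : 0 ≤ ∫ x, f 1 x := integral_nonneg (hf0 1)
    have p2 : 0 ≤ ∫ x, f 2 x := integral_nonneg (hf0 2)
    gcongr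
  have hF0 : ∀ x, 0 ≤ F x := fun x => Finset.prod_nonneg fun i _ => hf0 i _
  have hFψ : Integrable (fun ζ => F (ψ ζ)) := hmp.integrable_comp_of_integrable hFi
  have hFψint : ∫ ζ, F (ψ ζ) = ∫ x, F x := by
    rw [← hmp.map_eq, integral_map hmp.measurable.aemeasurable]
    rw [hmp.map_eq]; exact hFi.aestronglyMeasurable
  set V := Real.sqrt (1 + ‖v‖ ^ 2) with hV
  have hV1 : 1 ≤ V := by
    rw [hV]; exact Real.one_le_sqrt.mpr (by nlinarith [sq_nonneg ‖v‖])
  set M := 2 ^ (ρ / 2) * A * V ^ ρ with hM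
  have hM0 : 0 ≤ M := by positivity
  have hane : ∀ i, ∀ᵐ ζ : EuclideanSpace ℝ (Fin 3), ψ ζ i ≠ a i := by
    intro i
    have h1 : ∀ᵐ s : ℝ, s ≠ a i := (Set.countable_singleton (a i)).ae_notMem volume
    exact ((Measure.quasiMeasurePreserving_eval (μ := fun _ : Fin 3 => (volume : Measure ℝ)) i).comp
      hmp.quasiMeasurePreserving).ae h1
  have hdom : ∀ᵐ ζ : EuclideanSpace ℝ (Fin 3),
      Real.exp (-c * ‖v - ζ‖ ^ 2) / ‖v - ζ‖ * Real.sqrt (1 + ‖ζ‖ ^ 2) ^ ρ /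
            (|⟪n, ζ⟫ / ‖ζ‖| ^ (2 * β) * ‖ζ‖ ^ (2 * β)) ≤ M * F (ψ ζ) := by
    filter_upwards [hane 1, hane 2] with ζ h1 h2
    have hinner : ⟪n, ζ⟫ = ψ ζ 0 := by
      simp only [hψ]; rw [b.repr_apply_apply, hb]
    have hden : |⟪n, ζ⟫ / ‖ζ‖| ^ (2 * β) * ‖ζ‖ ^ (2 * β) = |ψ ζ 0| ^ (2 * β) := by
      rw [← hinner, ← Real.mul_rpow (abs_nonneg _) (norm_nonneg _)]
      congr 1
      by_cases hz : ζ = 0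
      · simp [hz]
      · rw [abs_div, abs_norm, div_mul_cancel₀ _ (norm_ne_zero_iff.mpr hz)]
    rw [hden]
    set w := v - ζ with hw
    have hwn : ‖w‖ ^ 2 = (a 0 - ψ ζ 0) ^ 2 + (a 1 - ψ ζ 1) ^ 2 + (a 2 - ψ ζ 2) ^ 2 := by
      rw [← b.repr.norm_map w, EuclideanSpace.real_norm_sq_eq, Fin.sum_univ_three]
      simp [hw, ha, hψ]
    have hFe : F (ψ ζ) = Real.exp (-(c / 2) * ‖w‖ ^ 2) *
        (|ψ ζ 0| ^ (-(2 * β)) * (|a 1 - ψ ζ 1| ^ (-(1 / 2 : ℝ)) * |a 2 - ψ ζ 2| ^ (-(1 / 2 : ℝ)))) := by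
      simp only [hF, Fin.prod_univ_three, hf, if_true, one_ne_zero, if_false,
        (by decide : (2 : Fin 3) ≠ 0)]
      rw [hwn, mul_add, mul_add, Real.exp_add, Real.exp_add, zero_sub, abs_neg]
      ring
    have q1 : 0 < |a 1 - ψ ζ 1| := abs_pos.mpr (sub_ne_zero.mpr h1.symm)
    have q2 : 0 < |a 2 - ψ ζ 2| := abs_pos.mpr (sub_ne_zero.mpr h2.symm)
    have r1 : |a 1 - ψ ζ 1| ≤ ‖w‖ := by
      refine abs_le_of_sq_le_sq ?_ (norm_nonneg _)
      nlinarith [sq_nonneg (a 0 - ψ ζ 0), sq_nonneg (a 2 - ψ ζ 2)]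
    have r2 : |a 2 - ψ ζ 2| ≤ ‖w‖ := by
      refine abs_le_of_sq_le_sq ?_ (norm_nonneg _)
      nlinarith [sq_nonneg (a 0 - ψ ζ 0), sq_nonneg (a 1 - ψ ζ 1)]
    have hw0 : 0 < ‖w‖ := q1.trans_le r1
    have hinv : ‖w‖⁻¹ ≤ |a 1 - ψ ζ 1| ^ (-(1 / 2 : ℝ)) * |a 2 - ψ ζ 2| ^ (-(1 / 2 : ℝ)) := by
      calc ‖w‖⁻¹ = ‖w‖ ^ (-(1 / 2 : ℝ)) * ‖w‖ ^ (-(1 / 2 : ℝ)) := by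
            rw [← Real.rpow_add hw0, ← Real.rpow_neg_one]; norm_num
        _ ≤ _ := by
            have s1 := Real.rpow_le_rpow_of_nonpos q1 r1 (by norm_num : -(1 / 2 : ℝ) ≤ 0)
            have s2 := Real.rpow_le_rpow_of_nonpos q2 r2 (by norm_num : -(1 / 2 : ℝ) ≤ 0)
            gcongr
    have hpeetre : Real.sqrt (1 + ‖ζ‖ ^ 2) ^ ρ ≤
        2 ^ (ρ / 2) * V ^ ρ * (1 + ‖w‖ ^ 2) ^ (ρ / 2) := by
      have hz : ‖ζ‖ ≤ ‖v‖ + ‖w‖ := by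
        have : ζ = v - w := by rw [hw]; abel
        rw [this]; exact norm_sub_le _ _
      have hz2 : 1 + ‖ζ‖ ^ 2 ≤ 2 * (1 + ‖v‖ ^ 2) * (1 + ‖w‖ ^ 2) := by
        have : ‖ζ‖ ^ 2 ≤ (‖v‖ + ‖w‖) ^ 2 := by gcongr
        nlinarith [sq_nonneg (‖v‖ - ‖w‖), mul_nonneg (sq_nonneg ‖v‖) (sq_nonneg ‖w‖)]
      rw [hV, sqrt_rpow_half _ _ (by positivity), sqrt_rpow_half _ _ (by positivity),
        ← Real.mul_rpow (by positivity) (by positivity),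
        ← Real.mul_rpow (by positivity) (by positivity)]
      exact Real.rpow_le_rpow (by positivity) hz2 (by positivity)
    have hg := hG (‖w‖ ^ 2) (by positivity)
    rw [hFe, Real.rpow_neg (abs_nonneg (ψ ζ 0)), div_eq_mul_inv, div_eq_mul_inv]
    calc Real.exp (-c * ‖w‖ ^ 2) * ‖w‖⁻¹ * Real.sqrt (1 + ‖ζ‖ ^ 2) ^ ρ * (|ψ ζ 0| ^ (2 * β))⁻¹
        ≤ Real.exp (-c * ‖w‖ ^ 2) *
          (|a 1 - ψ ζ 1| ^ (-(1 / 2 : ℝ)) * |a 2 - ψ ζ 2| ^ (-(1 / 2 : ℝ))) *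
          (2 ^ (ρ / 2) * V ^ ρ * (1 + ‖w‖ ^ 2) ^ (ρ / 2)) * (|ψ ζ 0| ^ (2 * β))⁻¹ := by
          gcongr
      _ = (Real.exp (-c * ‖w‖ ^ 2) * (1 + ‖w‖ ^ 2) ^ (ρ / 2)) * (2 ^ (ρ / 2) * V ^ ρ *
          (|a 1 - ψ ζ 1| ^ (-(1 / 2 : ℝ)) * |a 2 - ψ ζ 2| ^ (-(1 / 2 : ℝ))) *
            (|ψ ζ 0| ^ (2 * β))⁻¹) := by ring
      _ ≤ (A * Real.exp (-(c / 2) * ‖w‖ ^ 2)) * (2 ^ (ρ / 2) * V ^ ρ *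
          (|a 1 - ψ ζ 1| ^ (-(1 / 2 : ℝ)) * |a 2 - ψ ζ 2| ^ (-(1 / 2 : ℝ))) *
            (|ψ ζ 0| ^ (2 * β))⁻¹) := by gcongr
      _ = _ := by rw [hM]; ring
  have hMi : Integrable (fun ζ => M * F (ψ ζ)) := hFψ.const_mul M
  calc _ ≤ ∫ ζ in {ζ : EuclideanSpace ℝ (Fin 3) | ⟪ζ, n⟫ ≤ 0}, M * F (ψ ζ) := by
        refine integral_mono_of_nonneg (Filter.Eventually.of_forall fun ζ => ?_)
          hMi.integrableOn (ae_restrict_of_ae hdom)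
        simp only [Pi.zero_apply]
        positivity
    _ ≤ ∫ ζ, M * F (ψ ζ) := setIntegral_le_integral hMi
        (Filter.Eventually.of_forall fun ζ => mul_nonneg hM0 (hF0 _))
    _ = M * ∫ x, F x := by rw [integral_const_mul, hFψint]
    _ ≤ M * (K₀ * L * L) := by gcongr
    _ = (2 ^ (ρ / 2) * A * (K₀ * L * L)) * V ^ ρ := by rw [hM]; ring
    _ ≤ (2 ^ (ρ / 2) * A * (K₀ * L * L) + 1) * V ^ (ρ + 1 - 2 * β) := by
        have : V ^ ρ ≤ V ^ (ρ + 1 - 2 * β) :=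
          Real.rpow_le_rpow_of_exponent_le hV1 (by linarith)
        gcongr
        linarith
end

section
/- Integrability of the squared grazing weight for the convex case: for 0 < β < 1/4, c > 0, r ≥ 0, x ∈ ℝ³ with r₀ < |x|_p < R, the integral ∫_{ℝ³} e^{−c|ζ|²}/|ζ| · ⟨v+ζ⟩^r / (cos a(x, v+ζ))^{4β} dζ ≤ C_β ⟨v⟩^{r+1}, uniformly in v ∈ ℝ³ and x, where cos a(x,w) = √(1 − |x|_p²/R² + (x_p·ŵ_p)²/R²). -/
open Real MeasureTheory

/-- half-line weight -/
noncomputable def auxF (γ : ℝ) : ℝ → ℝ :=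
  Set.indicator (Set.Ioi 0) (fun u : ℝ => u ^ (-γ) * Real.exp (-1 * u ^ 2))

/-- one-dimensional dominating function -/
noncomputable def auxK (c γ a : ℝ) (t : ℝ) : ℝ :=
  Real.exp (-(c / 2) * t ^ 2) + Real.exp 1 * (auxF γ (a + t) + auxF γ (-(a + t)))

lemma auxF_nonneg (γ u : ℝ) : 0 ≤ auxF γ u := by
  unfold auxF
  apply Set.indicator_nonneg
  intro x hx
  have : (0:ℝ) < x := hx
  positivity

lemma auxF_integrable {γ : ℝ} (h : γ < 1) : Integrable (auxF γ) := by
  unfold auxF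
  rw [integrable_indicator_iff measurableSet_Ioi]
  exact integrableOn_rpow_mul_exp_neg_mul_sq one_pos (by linarith)

lemma auxH_integrable {γ : ℝ} (h : γ < 1) :
    Integrable (fun u : ℝ => auxF γ u + auxF γ (-u)) :=
  (auxF_integrable h).add (auxF_integrable h).comp_neg

lemma auxK_integrable {c γ : ℝ} (hc : 0 < c) (h : γ < 1) (a : ℝ) : Integrable (auxK c γ a) := by
  unfold auxK
  exact (integrable_exp_neg_mul_sq (half_pos hc)).add
    (((auxH_integrable h).comp_add_left a).const_mul _)

lemma auxK_integral {c γ : ℝ} (hc : 0 < c) (h : γ < 1) (a : ℝ) :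
    ∫ t, auxK c γ a t = ∫ t, auxK c γ 0 t := by
  have key : ∀ a, ∫ t, auxK c γ a t = (∫ t : ℝ, Real.exp (-(c / 2) * t ^ 2)) +
      Real.exp 1 * ∫ u : ℝ, (auxF γ u + auxF γ (-u)) := by
    intro a
    unfold auxK
    rw [integral_add (integrable_exp_neg_mul_sq (half_pos hc))
      (((auxH_integrable h).comp_add_left a).const_mul _), integral_const_mul,
      integral_add_left_eq_self (fun u : ℝ => auxF γ u + auxF γ (-u)) a]
  rw [key a, key 0]

lemma auxK_nonneg (c γ a t : ℝ) : 0 ≤ auxK c γ a t := by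
  unfold auxK
  have := auxF_nonneg γ (a + t)
  have := auxF_nonneg γ (-(a + t))
  positivity

lemma auxF_lower {γ u : ℝ} (hu : 0 < u) (hu1 : u ≤ 1) :
    u ^ (-γ) ≤ Real.exp 1 * auxF γ u := by
  unfold auxF
  rw [Set.indicator_of_mem (by exact hu)]
  have h1 : 1 ≤ Real.exp 1 * Real.exp (-1 * u ^ 2) := by
    rw [← Real.exp_add]
    apply Real.one_le_exp
    nlinarith
  have h2 : 0 ≤ u ^ (-γ) := by positivity
  nlinarith

lemma auxK_lower {c γ a t : ℝ} (hc : 0 < c) (hγ : 0 ≤ γ) (h : a + t ≠ 0) :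
    Real.exp (-(c / 2) * t ^ 2) * |a + t| ^ (-γ) ≤ auxK c γ a t := by
  have e1 : Real.exp (-(c / 2) * t ^ 2) ≤ 1 := by
    apply Real.exp_le_one_iff.mpr
    nlinarith [sq_nonneg t]
  have e0 := Real.exp_pos (-(c / 2) * t ^ 2)
  have p0 : 0 < |a + t| := abs_pos.mpr h
  have q0 : 0 ≤ |a + t| ^ (-γ) := by positivity
  have f1 := auxF_nonneg γ (a + t)
  have f2 := auxF_nonneg γ (-(a + t))
  have x0 := Real.exp_pos 1
  unfold auxK
  rcases le_or_gt |a + t| 1 with h1 | h1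
  · have h3 : |a + t| ^ (-γ) ≤ Real.exp 1 * (auxF γ (a + t) + auxF γ (-(a + t))) := by
      have := auxF_lower (γ := γ) p0 h1
      rcases abs_choice (a + t) with h2 | h2
      · rw [h2] at this ⊢; nlinarith
      · rw [h2] at this ⊢; nlinarith
    nlinarith
  · have h3 : |a + t| ^ (-γ) ≤ 1 := Real.rpow_le_one_of_one_le_of_nonpos h1.le (by linarith)
    have : 0 ≤ Real.exp 1 * (auxF γ (a + t) + auxF γ (-(a + t))) := by positivity
    nlinarith

lemma aux_inv_norm {n y z : ℝ} (hn : 0 ≤ n) (hy : y ≠ 0) (hz : z ≠ 0)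
    (h : y ^ 2 + z ^ 2 ≤ n ^ 2) :
    1 / n ≤ |0 + y| ^ (-(1/2 : ℝ)) * |0 + z| ^ (-(1/2 : ℝ)) := by
  have hy' := abs_pos.mpr hy
  have hz' := abs_pos.mpr hz
  have hn0 : 0 < n := by
    rcases hn.eq_or_lt with h0 | h0
    · subst h0
      have : 0 < y ^ 2 := by positivity
      nlinarith [sq_nonneg z]
    · exact h0
  rw [zero_add, zero_add, ← Real.mul_rpow hy'.le hz'.le, Real.rpow_neg (by positivity),
    ← Real.sqrt_eq_rpow, one_div]
  apply inv_anti₀ (by positivity)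
  apply Real.sqrt_le_iff.mpr ⟨hn, ?_⟩
  nlinarith [sq_abs y, sq_abs z, sq_nonneg (|y| - |z|), sq_nonneg y, sq_nonneg z]

lemma aux_bracket (V : EuclideanSpace ℝ (Fin 3)) : 1 ≤ Real.sqrt (1 + ‖V‖ ^ 2) := by
  rw [Real.one_le_sqrt]; nlinarith [sq_nonneg ‖V‖]

lemma aux_peetre (v ζ : EuclideanSpace ℝ (Fin 3)) :
    Real.sqrt (1 + ‖v + ζ‖ ^ 2) ≤
      Real.sqrt 2 * Real.sqrt (1 + ‖v‖ ^ 2) * Real.sqrt (1 + ‖ζ‖ ^ 2) := by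
  rw [← Real.sqrt_mul (by norm_num), ← Real.sqrt_mul (by positivity)]
  apply Real.sqrt_le_sqrt
  have h := norm_add_le v ζ
  have h1 : ‖v + ζ‖ ^ 2 ≤ (‖v‖ + ‖ζ‖) ^ 2 := by gcongr
  nlinarith [sq_nonneg (‖v‖ - ‖ζ‖), sq_nonneg (‖v‖ * ‖ζ‖)]

lemma aux_gauss {c p : ℝ} (hc : 0 < c) (hp : 0 < p) (n : ℝ) :
    Real.sqrt (1 + n ^ 2) ^ p * Real.exp (-(c / 2) * n ^ 2) ≤
      (2 * p / c) ^ p * Real.exp (c / 2) := by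
  set u := 1 + n ^ 2 with hu
  have hu1 : 1 ≤ u := by nlinarith [sq_nonneg n]
  have h1 : Real.sqrt u ≤ u := by
    rw [Real.sqrt_le_iff]; constructor <;> nlinarith
  have h2 : u ≤ (2 * p / c) * Real.exp (c * u / (2 * p)) := by
    have h3 := Real.add_one_le_exp (c * u / (2 * p))
    have h4 : u = (2 * p / c) * (c * u / (2 * p)) := by field_simp
    have h5 : 0 < 2 * p / c := by positivity
    calc u = (2 * p / c) * (c * u / (2 * p)) := h4
      _ ≤ _ := by gcongr; linarith
  have h6 : Real.sqrt u ^ p ≤ (2 * p / c) ^ p * Real.exp (c / 2 * u) := by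
    calc Real.sqrt u ^ p ≤ ((2 * p / c) * Real.exp (c * u / (2 * p))) ^ p :=
          Real.rpow_le_rpow (Real.sqrt_nonneg _) (h1.trans h2) hp.le
      _ = (2 * p / c) ^ p * Real.exp (c / 2 * u) := by
          rw [Real.mul_rpow (by positivity) (by positivity), ← Real.exp_mul]
          congr 2
          field_simp
  calc _ ≤ (2 * p / c) ^ p * Real.exp (c / 2 * u) * Real.exp (-(c / 2) * n ^ 2) := by gcongr
    _ = _ := by
      rw [mul_assoc, ← Real.exp_add]
      congr 2
      rw [hu]; ring

/-- the grazing cosine is bounded below -/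
lemma aux_cos {γ s R a b w0 w1 B : ℝ} (hγ : 0 ≤ γ) (hγ1 : γ ≤ 1) (hs : 0 < s) (hsR : s < R)
    (hab : a ^ 2 + b ^ 2 = 1) (he : a * w0 + b * w1 ≠ 0)
    (hB : 1 ≤ B) (hwB : Real.sqrt (w0 ^ 2 + w1 ^ 2) ≤ B) :
    1 / Real.sqrt (1 - s ^ 2 / R ^ 2 +
      ((s * a * w0 + s * b * w1) / Real.sqrt (w0 ^ 2 + w1 ^ 2)) ^ 2 / R ^ 2) ^ γ
      ≤ B * |a * w0 + b * w1| ^ (-γ) := by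
  have hR : 0 < R := hs.trans hsR
  set d := a * w0 + b * w1 with hd
  have hw : 0 < w0 ^ 2 + w1 ^ 2 := by
    rcases (by positivity : 0 ≤ w0 ^ 2 + w1 ^ 2).eq_or_lt with h | h
    · exfalso; apply he
      have h0 : w0 = 0 := by nlinarith [sq_nonneg w0, sq_nonneg w1]
      have h1 : w1 = 0 := by nlinarith [sq_nonneg w0, sq_nonneg w1]
      simp [hd, h0, h1]
    · exact h
  set m := Real.sqrt (w0 ^ 2 + w1 ^ 2) with hm
  have hm0 : 0 < m := Real.sqrt_pos.mpr hw
  have hm2 : m ^ 2 = w0 ^ 2 + w1 ^ 2 := Real.sq_sqrt hw.le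
  have hd0 : 0 < |d| := abs_pos.mpr he
  have hdm : d ^ 2 ≤ m ^ 2 := by
    rw [hm2, hd]; nlinarith [sq_nonneg (a * w1 - b * w0)]
  have hQ : (|d| / m) ^ 2 ≤ 1 - s ^ 2 / R ^ 2 + ((s * a * w0 + s * b * w1) / m) ^ 2 / R ^ 2 := by
    have e : ((s * a * w0 + s * b * w1) / m) ^ 2 / R ^ 2 = (s ^ 2 / R ^ 2) * (|d| / m) ^ 2 := by
      have : s * a * w0 + s * b * w1 = s * d := by rw [hd]; ring
      rw [this, div_pow, div_pow, sq_abs]; ring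
    rw [e]
    have hk : s ^ 2 / R ^ 2 ≤ 1 := by
      rw [div_le_one (by positivity)]; gcongr
    have hq : (|d| / m) ^ 2 ≤ 1 := by
      rw [div_pow, sq_abs, div_le_one (by positivity)]; exact hdm
    nlinarith
  have h1 : |d| / m ≤ Real.sqrt (1 - s ^ 2 / R ^ 2 + ((s * a * w0 + s * b * w1) / m) ^ 2 / R ^ 2) :=
    Real.le_sqrt_of_sq_le hQ
  have h2 : (|d| / m) ^ γ ≤ Real.sqrt (1 - s ^ 2 / R ^ 2 + ((s * a * w0 + s * b * w1) / m) ^ 2 / R ^ 2) ^ γ :=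
    Real.rpow_le_rpow (by positivity) h1 hγ
  calc _ ≤ 1 / (|d| / m) ^ γ := one_div_le_one_div_of_le (by positivity) h2
    _ = m ^ γ * |d| ^ (-γ) := by
        rw [Real.div_rpow hd0.le hm0.le, Real.rpow_neg hd0.le, one_div_div, div_eq_mul_inv]
    _ ≤ B * |d| ^ (-γ) := by
        gcongr
        calc m ^ γ ≤ B ^ γ := Real.rpow_le_rpow hm0.le hwB hγ
          _ ≤ B ^ (1:ℝ) := Real.rpow_le_rpow_of_exponent_le hB hγ1
          _ = B := Real.rpow_one B

lemma aux_basis (e : EuclideanSpace ℝ (Fin 3)) (he : ‖e‖ = 1) :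
    ∃ b : OrthonormalBasis (Fin 3) ℝ (EuclideanSpace ℝ (Fin 3)), b 0 = e := by
  have hv : Orthonormal ℝ (Set.domRestrict ({0} : Set (Fin 3)) (fun _ : Fin 3 => e)) := by
    constructor
    · intro i; simpa using he
    · intro i j hij
      exact absurd (Subsingleton.elim i j) hij
  obtain ⟨b, hb⟩ := hv.exists_orthonormalBasis_extension_of_card_eq (by simp)
  exact ⟨b, hb 0 rfl⟩

set_option maxHeartbeats 2000000 in
/-- integrability of the squared grazing weight for the convex case:
for `0 < β < 1/4`, `c > 0`, `ρ ≥ 0`, and `x` with `r₀ < |x|_p < R`,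
`∫_{ℝ³} e^{−c|ζ|²}/|ζ| · ⟨v+ζ⟩^ρ / (cos a(x, v+ζ))^{4β} dζ ≤ C ⟨v⟩^{ρ+1}`
uniformly in `v` and `x`, where
`cos a(x,w) = √(1 − |x|_p²/R² + (x_p·ŵ_p)²/R²)`. -/
theorem stmt_18 (β c ρ r₀ R : ℝ) (hβ0 : 0 < β) (hβ1 : β < 1 / 4) (hc : 0 < c)
    (hρ : 0 ≤ ρ) (hr : 0 < r₀) (hrR : r₀ < R) :
    ∃ C > 0, ∀ v x : EuclideanSpace ℝ (Fin 3),
      r₀ < Real.sqrt (x 0 ^ 2 + x 1 ^ 2) → Real.sqrt (x 0 ^ 2 + x 1 ^ 2) < R →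
      (∫ ζ : EuclideanSpace ℝ (Fin 3),
          Real.exp (-c * ‖ζ‖ ^ 2) / ‖ζ‖ * Real.sqrt (1 + ‖v + ζ‖ ^ 2) ^ ρ /
            Real.sqrt (1 - (x 0 ^ 2 + x 1 ^ 2) / R ^ 2 +
              ((x 0 * (v + ζ) 0 + x 1 * (v + ζ) 1) /
                Real.sqrt ((v + ζ) 0 ^ 2 + (v + ζ) 1 ^ 2)) ^ 2 / R ^ 2) ^ (4 * β))
        ≤ C * Real.sqrt (1 + ‖v‖ ^ 2) ^ (ρ + 1) := by
  set γ := 4 * β with hγ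
  have hγ0 : 0 ≤ γ := by linarith
  have hγ1 : γ < 1 := by linarith
  set M : ℝ := (2 * (ρ + 1) / c) ^ (ρ + 1) * Real.exp (c / 2) with hM
  have hM0 : 0 < M := by positivity
  set J : ℝ := (∫ t, auxK c γ 0 t) * (∫ t, auxK c (1/2) 0 t) * (∫ t, auxK c (1/2) 0 t) with hJ
  have hJ0 : 0 ≤ J := by
    have h1 : 0 ≤ ∫ t, auxK c γ 0 t := integral_nonneg (auxK_nonneg c γ 0)
    have h2 : 0 ≤ ∫ t, auxK c (1/2) 0 t := integral_nonneg (auxK_nonneg c (1/2) 0)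
    positivity
  set A : ℝ := Real.sqrt 2 ^ (ρ + 1) * M with hA
  have hA0 : 0 < A := by positivity
  refine ⟨A * (J + 1), by positivity, ?_⟩
  intro v x hx1 hx2
  set s := Real.sqrt (x 0 ^ 2 + x 1 ^ 2) with hs
  have hs0 : 0 < s := hr.trans hx1
  have hs2 : s ^ 2 = x 0 ^ 2 + x 1 ^ 2 := Real.sq_sqrt (by positivity)
  have hab : (x 0 / s) ^ 2 + (x 1 / s) ^ 2 = 1 := by
    rw [div_pow, div_pow, ← add_div, ← hs2]; field_simp
  have hxa : x 0 = s * (x 0 / s) := by field_simp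
  have hxb : x 1 = s * (x 1 / s) := by field_simp
  obtain ⟨b, hb⟩ := aux_basis (!₂[x 0 / s, x 1 / s, 0]) (by
    rw [EuclideanSpace.norm_eq]; simp [Fin.sum_univ_three]; simpa using hab)
  set a := x 0 / s * v 0 + x 1 / s * v 1 with ha
  have hrep : ∀ ζ, b.repr ζ 0 = x 0 / s * ζ 0 + x 1 / s * ζ 1 := by
    intro ζ
    rw [b.repr_apply_apply, hb, PiLp.inner_apply]
    simp [Fin.sum_univ_three]; ring
  set g : Fin 3 → ℝ → ℝ := ![auxK c γ a, auxK c (1/2) 0, auxK c (1/2) 0] with hg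
  set B := Real.sqrt (1 + ‖v‖ ^ 2) ^ (ρ + 1) with hB
  have hB0 : 0 < B := by
    have := aux_bracket v
    positivity
  have hmp : MeasurePreserving (fun ζ : EuclideanSpace ℝ (Fin 3) => WithLp.ofLp (b.repr ζ)) :=
    (PiLp.volume_preserving_ofLp (Fin 3)).comp b.measurePreserving_repr
  have hme : MeasurableEmbedding
      (fun ζ : EuclideanSpace ℝ (Fin 3) => WithLp.ofLp (b.repr ζ)) :=
    (MeasurableEquiv.toLp 2 (Fin 3 → ℝ)).symm.measurableEmbedding.comp
      b.repr.toHomeomorph.measurableEmbedding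
  have hgi : Integrable (fun y : Fin 3 → ℝ => ∏ i, g i (y i)) := by
    apply Integrable.fintype_prod
    intro i
    fin_cases i
    · exact auxK_integrable hc hγ1 a
    · exact auxK_integrable hc (by norm_num) 0
    · exact auxK_integrable hc (by norm_num) 0
  have hgv : ∫ y : Fin 3 → ℝ, ∏ i, g i (y i) = J := by
    rw [integral_fintype_prod_volume_eq_prod, Fin.prod_univ_three]
    simp only [hg, Matrix.cons_val_zero, Matrix.cons_val_one, Matrix.cons_val]
    rw [auxK_integral hc hγ1 a]
  have hGi : Integrable (fun ζ : EuclideanSpace ℝ (Fin 3) =>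
      A * B * ∏ i, g i (b.repr ζ i)) := by
    apply Integrable.const_mul
    exact (hmp.integrable_comp_emb hme).mpr hgi
  have hGv : ∫ ζ : EuclideanSpace ℝ (Fin 3), A * B * ∏ i, g i (b.repr ζ i) = A * B * J := by
    rw [integral_const_mul, ← hgv]
    congr 1
    exact hmp.integral_comp hme (fun y : Fin 3 → ℝ => ∏ i, g i (y i))
  have hae : ∀ i (z : ℝ), ∀ᵐ ζ : EuclideanSpace ℝ (Fin 3), b.repr ζ i ≠ z := by
    intro i z
    have h := Measure.ae_eval_ne (μ := fun _ : Fin 3 => (volume : Measure ℝ)) i z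
    exact hmp.quasiMeasurePreserving.ae h
  calc _ ≤ ∫ ζ : EuclideanSpace ℝ (Fin 3), A * B * ∏ i, g i (b.repr ζ i) := by
        apply integral_mono_of_nonneg
        · exact Filter.Eventually.of_forall fun ζ => by positivity
        · exact hGi
        · filter_upwards [hae 0 (-a), hae 1 0, hae 2 0] with ζ h0 h1 h2
          set y0 := b.repr ζ 0 with hy0
          set y1 := b.repr ζ 1 with hy1
          set y2 := b.repr ζ 2 with hy2
          have hn : ‖ζ‖ ^ 2 = y0 ^ 2 + y1 ^ 2 + y2 ^ 2 := by
            rw [← b.repr.norm_map ζ, EuclideanSpace.norm_sq_eq, Fin.sum_univ_three]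
            simp only [Real.norm_eq_abs, sq_abs, hy0, hy1, hy2]
          have hat : x 0 / s * (v + ζ) 0 + x 1 / s * (v + ζ) 1 = a + y0 := by
            rw [hy0, hrep, ha]; simp; ring
          have hat0 : a + y0 ≠ 0 := fun h => h0 (by linarith)
          set W := Real.sqrt (1 + ‖v + ζ‖ ^ 2) with hW
          have hW1 : 1 ≤ W := aux_bracket _
          have hcos := aux_cos (γ := γ) (s := s) (R := R) (a := x 0 / s) (b := x 1 / s)
            (w0 := (v + ζ) 0) (w1 := (v + ζ) 1) (B := W) hγ0 hγ1.le hs0 hx2 hab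
            (by rw [hat]; exact hat0) hW1 (by
              apply Real.sqrt_le_sqrt
              rw [EuclideanSpace.norm_sq_eq, Fin.sum_univ_three]
              simp only [Real.norm_eq_abs, sq_abs]
              nlinarith [sq_nonneg ((v + ζ) 2)])
          rw [hat, ← hxa, ← hxb, hs2] at hcos
          have hinv := aux_inv_norm (norm_nonneg ζ) h1 h2 (by rw [hn]; nlinarith [sq_nonneg y0])
          have k0 := auxK_lower (c := c) (γ := γ) (a := a) (t := y0) hc hγ0 hat0
          have k1 := auxK_lower (c := c) (γ := 1/2) (a := 0) (t := y1) hc (by norm_num) (by simpa using h1)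
          have k2 := auxK_lower (c := c) (γ := 1/2) (a := 0) (t := y2) hc (by norm_num) (by simpa using h2)
          have hprod : ∏ i, g i (b.repr ζ i) =
              auxK c γ a y0 * auxK c (1/2) 0 y1 * auxK c (1/2) 0 y2 := by
            rw [Fin.prod_univ_three]; rfl
          have hE : Real.exp (-c * ‖ζ‖ ^ 2) = Real.exp (-(c / 2) * ‖ζ‖ ^ 2) *
              (Real.exp (-(c / 2) * y0 ^ 2) * Real.exp (-(c / 2) * y1 ^ 2) *
                Real.exp (-(c / 2) * y2 ^ 2)) := by
            rw [← Real.exp_add, ← Real.exp_add, ← Real.exp_add, hn]; congr 1; ring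
          have hWp : W ^ ρ * W ≤ Real.sqrt 2 ^ (ρ + 1) * B * Real.sqrt (1 + ‖ζ‖ ^ 2) ^ (ρ + 1) := by
            have e1 : W ^ ρ * W = W ^ (ρ + 1) := by
              rw [Real.rpow_add (by linarith), Real.rpow_one]
            rw [e1, hB, ← Real.mul_rpow (by positivity) (by positivity),
              ← Real.mul_rpow (by positivity) (by positivity)]
            exact Real.rpow_le_rpow (by positivity) (aux_peetre v ζ) (by linarith)
          have hgs := aux_gauss hc (by linarith : 0 < ρ + 1) ‖ζ‖
          rw [← hM] at hgs
          rw [hprod]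
          set D := Real.sqrt (1 - (x 0 ^ 2 + x 1 ^ 2) / R ^ 2 +
              ((x 0 * (v + ζ) 0 + x 1 * (v + ζ) 1) /
                Real.sqrt ((v + ζ) 0 ^ 2 + (v + ζ) 1 ^ 2)) ^ 2 / R ^ 2) ^ γ with hD
          set E := Real.exp (-(c / 2) * ‖ζ‖ ^ 2)
          set E0 := Real.exp (-(c / 2) * y0 ^ 2)
          set E1 := Real.exp (-(c / 2) * y1 ^ 2)
          set E2 := Real.exp (-(c / 2) * y2 ^ 2)
          set S := Real.sqrt (1 + ‖ζ‖ ^ 2) ^ (ρ + 1)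
          set P0 := |a + y0| ^ (-γ)
          set P1 := |0 + y1| ^ (-(1/2:ℝ))
          set P2 := |0 + y2| ^ (-(1/2:ℝ))
          have hE0 : 0 < E := Real.exp_pos _
          calc Real.exp (-c * ‖ζ‖ ^ 2) / ‖ζ‖ * W ^ ρ / D
              = (E * (E0 * E1 * E2)) * (1 / ‖ζ‖) * W ^ ρ * (1 / D) := by rw [hE]; ring
            _ ≤ (E * (E0 * E1 * E2)) * (P1 * P2) * W ^ ρ * (W * P0) := by gcongr
            _ = E * ((E0 * P0) * (E1 * P1) * (E2 * P2)) * (W ^ ρ * W) := by ring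
            _ ≤ E * ((E0 * P0) * (E1 * P1) * (E2 * P2)) * (Real.sqrt 2 ^ (ρ + 1) * B * S) := by
                gcongr
            _ = (Real.sqrt 2 ^ (ρ + 1) * (S * E) * B) *
                  ((E0 * P0) * (E1 * P1) * (E2 * P2)) := by ring
            _ ≤ (Real.sqrt 2 ^ (ρ + 1) * M * B) *
                  (auxK c γ a y0 * auxK c (1/2) 0 y1 * auxK c (1/2) 0 y2) := by
                have := auxK_nonneg c γ a y0
                have := auxK_nonneg c (1/2) 0 y1
                have := auxK_nonneg c (1/2) 0 y2
                gcongr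
    _ = A * B * J := hGv
    _ ≤ A * (J + 1) * B := by nlinarith [mul_pos hA0 hB0]
end
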